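/- Let G be a nonzero real m × n matrix and define the Newton–Schulz iterates by G₀ := G / ‖G‖_F and G_{t+1} := (15/8)·G_t − (5/4)·(G_t·G_tᵀ)·G_t + (3/8)·(G_t·G_tᵀ)·(G_t·G_tᵀ)·G_t. Then for every natural number T, the m × m matrix I − G_T·G_Tᵀ is positive semidefinite; equivalently, the spectral norm of G_T is at most 1. -/

import Mathlib

open Matrix

theorem newton_schulz_residual {R m n : Type*} [Field R] [CharZero R] [Fintype m] [DecidableEq m]
    [Fintype n] (X Y : Matrix m n R)
    (hY : Y = (15 / 8 : R) • X - (5 / 4 : R) • (X * Xᵀ * X)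
      + (3 / 8 : R) • (X * Xᵀ * (X * Xᵀ) * X)) :
    1 - Y * Yᵀ = (5 / 8 : R) • (1 - X * Xᵀ) ^ 3 + (15 / 64 : R) • (1 - X * Xᵀ) ^ 4
      + (9 / 64 : R) • (1 - X * Xᵀ) ^ 5 := by
  obtain ⟨A, hA⟩ : ∃ A, A = X * Xᵀ := ⟨_, rfl⟩
  have hAt : Aᵀ = A := by simp [hA]
  obtain ⟨P, hP⟩ : ∃ P, P = (15 / 8 : R) • (1 : Matrix m m R) - (5 / 4 : R) • A
    + (3 / 8 : R) • (A * A) := ⟨_, rfl⟩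
  have hYP : Y = P * X := by
    rw [hY, hP, ← hA]
    simp [Matrix.add_mul, Matrix.sub_mul]
  have hPt : Pᵀ = P := by simp [hP, hAt]
  have hYY : Y * Yᵀ = P * A * P := by
    rw [hYP, transpose_mul, hPt, hA]
    simp only [Matrix.mul_assoc]
  rw [hYY, ← hA, hP]
  simp only [pow_succ, pow_zero, one_mul, mul_one, mul_add, add_mul, mul_sub, sub_mul,
    smul_mul_assoc, mul_smul_comm, mul_assoc]
  module

theorem sum_sq_vecMul_le {m n : Type*} [Fintype m] [Fintype n] (G : Matrix m n ℝ) (x : m → ℝ) :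
    ∑ j, (x ᵥ* G) j ^ 2 ≤ (∑ i, x i ^ 2) * ∑ i, ∑ j, G i j ^ 2 := by
  rw [Finset.sum_comm, Finset.mul_sum]
  exact Finset.sum_le_sum fun j _ => Finset.sum_mul_sq_le_sq_mul_sq _ x fun i => G i j

theorem posSemidef_one_sub_frobenius_normalized {m n : Type*} [Fintype m] [DecidableEq m]
    [Fintype n] (G X : Matrix m n ℝ)
    (hX : X = (Real.sqrt (∑ i, ∑ j, G i j ^ 2))⁻¹ • G) :
    (1 - X * Xᵀ).PosSemidef := by
  refine PosSemidef.of_dotProduct_mulVec_nonneg ?_ fun x => ?_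
  · simp [IsHermitian, conjTranspose_eq_transpose_of_trivial]
  have hX1 : ∑ i, ∑ j, X i j ^ 2 ≤ 1 := by
    have hS : 0 ≤ ∑ i, ∑ j, G i j ^ 2 := by positivity
    simp only [hX, Matrix.smul_apply, smul_eq_mul, mul_pow, ← Finset.mul_sum, inv_pow, Real.sq_sqrt hS]
    exact inv_mul_le_one
  have h := (sum_sq_vecMul_le X x).trans (mul_le_of_le_one_right (by positivity) hX1)
  have hq : x ⬝ᵥ ((X * Xᵀ) *ᵥ x) = ∑ j, (x ᵥ* X) j ^ 2 := by
    rw [← mulVec_mulVec, dotProduct_mulVec, mulVec_transpose]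
    simp [dotProduct, sq]
  rw [star_trivial, sub_mulVec, one_mulVec, dotProduct_sub, hq, sub_nonneg]
  simpa [dotProduct, sq] using h



theorem newton_schulz_spectral_norm_le_one (m n : ℕ)
    (G : Matrix (Fin m) (Fin n) ℝ) (hG : G ≠ 0)
    (Giter : ℕ → Matrix (Fin m) (Fin n) ℝ)
    (h0 : Giter 0 = (Real.sqrt (∑ i, ∑ j, G i j ^ 2))⁻¹ • G)
    (hrec : ∀ t, Giter (t + 1) =
      (15 / 8 : ℝ) • Giter t
        - (5 / 4 : ℝ) • (Giter t * (Giter t)ᵀ * Giter t)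
        + (3 / 8 : ℝ) • (Giter t * (Giter t)ᵀ * (Giter t * (Giter t)ᵀ) * Giter t)) :
    ∀ T : ℕ, ((1 : Matrix (Fin m) (Fin m) ℝ) - Giter T * (Giter T)ᵀ).PosSemidef := by
  intro T
  induction T with
  | zero => exact posSemidef_one_sub_frobenius_normalized G _ h0
  | succ t ih =>
    rw [newton_schulz_residual _ _ (hrec t)]
    exact (((ih.pow 3).smul (by norm_num)).add ((ih.pow 4).smul (by norm_num))).add
      ((ih.pow 5).smul (by norm_num))
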